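/- arXiv:1107.4137 — 5 statements merged into one kernel-verified Lean document; each statement's English description precedes it below -/
import Mathlib

section
/- The subring S of L generated over ℤ/2 by the theta series [1], …, [m] is stabilized by each of the projection operators p_{8,0}, p_{8,1}, …, p_{8,7}; that is, p_{8,j}(S) ⊆ S for 0 ≤ j < 8. -/
open scoped Classical

/-- The theta series `[i]` for modulus `l`: `∑ x^(n²)` over integers `n ≡ i (mod l)`,
viewed in `ℤ/2[[x]]` (the coefficient of `x^k` is the mod-2 count of such `n` with `n² = k`). -/
noncomputable def theta (l i : ℤ) : PowerSeries (ZMod 2) :=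
  PowerSeries.mk fun k => (({n : ℤ | n ≡ i [ZMOD l] ∧ n ^ 2 = (k : ℤ)}.ncard : ℕ) : ZMod 2)

/-- The theta series viewed in the Laurent series field `L = ℤ/2((x))`. -/
noncomputable def thetaL (l i : ℤ) : LaurentSeries (ZMod 2) := (theta l i : LaurentSeries (ZMod 2))

/-- The projection `p_{q,j}` keeping only the coefficients in degrees `≡ j (mod q)`. -/
noncomputable def proj (q j : ℤ) (f : LaurentSeries (ZMod 2)) : LaurentSeries (ZMod 2) where
  coeff n := if n ≡ j [ZMOD q] then f.coeff n else 0
  isPWO_support' := f.isPWO_support'.mono (fun n hn => by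
    simp only [Function.mem_support, ne_eq] at hn ⊢
    intro h; apply hn; split_ifs <;> simp [h])

/-- `B(g)`: the set of integers `n` such that the coefficient of `x^n` in `1/g` is `1`. -/
noncomputable def Bset (g : PowerSeries (ZMod 2)) : Set ℤ :=
  {n : ℤ | ((g : LaurentSeries (ZMod 2))⁻¹).coeff n = 1}

/-- The subring `S` of `L` generated over `ℤ/2` by `[1], …, [m]`. -/
noncomputable def Sring (l : ℤ) (m : ℕ) : Subring (LaurentSeries (ZMod 2)) :=
  Subring.closure {x | ∃ i : ℕ, 1 ≤ i ∧ i ≤ m ∧ x = thetaL l i}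

/-- The subring `S` of `ℤ/2[[x]]` generated over `ℤ/2` by `[1], …, [m]`. -/
noncomputable def SringPS (l : ℤ) (m : ℕ) : Subring (PowerSeries (ZMod 2)) :=
  Subring.closure {x | ∃ i : ℕ, 1 ≤ i ∧ i ≤ m ∧ x = theta l i}

theorem theta_congr {l i i' : ℤ} (h : i ≡ i' [ZMOD l]) : theta l i = theta l i' := by
  ext k
  have : ∀ n : ℤ, n ≡ i [ZMOD l] ↔ n ≡ i' [ZMOD l] := fun n =>
    ⟨fun hn => hn.trans h, fun hn => hn.trans h.symm⟩
  simp only [theta, PowerSeries.coeff_mk, this]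

theorem theta_neg (l i : ℤ) : theta l (-i) = theta l i := by
  ext k
  simp only [theta, PowerSeries.coeff_mk]
  congr 1
  refine Set.ncard_congr' ((Equiv.neg ℤ).subtypeEquiv fun n => ?_)
  have : n ≡ -i [ZMOD l] ↔ -n ≡ i [ZMOD l] :=
    ⟨fun h => by simpa using h.neg, fun h => by simpa using h.neg⟩
  simp [this]

theorem theta_zero (l : ℤ) : theta l 0 = 1 := by
  ext k
  simp only [theta, PowerSeries.coeff_mk, PowerSeries.coeff_one]
  split_ifs with hk
  · subst hk
    have : {n : ℤ | n ≡ 0 [ZMOD l] ∧ n ^ 2 = ((0 : ℕ) : ℤ)} = {0} := by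
      ext n
      simp only [Set.mem_ofPred_eq, Nat.cast_zero, Set.mem_singleton_iff]
      refine ⟨fun h => by simpa using h.2, ?_⟩
      rintro rfl
      exact ⟨Int.ModEq.refl _, by simp⟩
    rw [this, Set.ncard_singleton, Nat.cast_one]
  · rcases Set.eq_empty_or_nonempty {n : ℤ | n ≡ 0 [ZMOD l] ∧ n ^ 2 = (k : ℤ)} with h | ⟨n, hn⟩
    · simp [h]
    · have hn0 : n ≠ 0 := by
        rintro rfl
        have := hn.2
        exact hk (by exact_mod_cast (show (k : ℤ) = 0 by simpa using this.symm))
      have : {n : ℤ | n ≡ 0 [ZMOD l] ∧ n ^ 2 = (k : ℤ)} = {n, -n} := by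
        ext p
        simp only [Set.mem_ofPred_eq, Set.mem_insert_iff, Set.mem_singleton_iff]
        constructor
        · intro hp
          exact sq_eq_sq_iff_eq_or_eq_neg.mp (hp.2.trans hn.2.symm)
        · rintro (rfl | rfl)
          · exact hn
          · exact ⟨by simpa using hn.1.neg, by simpa using hn.2⟩
      rw [this, Set.ncard_pair (by omega)]
      rfl

theorem PowerSeries.coeff_pow_two_pow (f : PowerSeries (ZMod 2)) (e k : ℕ) :
    PowerSeries.coeff k (f ^ 2 ^ e) =
      if 2 ^ e ∣ k then PowerSeries.coeff (k / 2 ^ e) f else 0 := by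
  have h : iterateFrobenius (ZMod 2) 2 e = RingHom.id _ := RingHom.ext_zmod _ _
  have h' := MvPowerSeries.map_iterateFrobenius_expand 2 two_ne_zero f e
  rw [h, MvPowerSeries.map_id, RingHom.id_apply] at h'
  rw [← PowerSeries.coeff_expand (2 ^ e) (pow_ne_zero e two_ne_zero)]
  exact congrArg (PowerSeries.coeff k) h'.symm

theorem coeff_theta_of_four_dvd {l i i' : ℤ} (hl : Odd l) (hi : 2 * i' ≡ i [ZMOD l]) (k : ℕ) :
    PowerSeries.coeff (4 * k) (theta l i) = PowerSeries.coeff k (theta l i') := by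
  simp only [theta, PowerSeries.coeff_mk]
  have : {n : ℤ | n ≡ i [ZMOD l] ∧ n ^ 2 = ((4 * k : ℕ) : ℤ)} =
      (fun n => 2 * n) '' {n : ℤ | n ≡ i' [ZMOD l] ∧ n ^ 2 = (k : ℤ)} := by
    ext n
    simp only [Set.mem_ofPred_eq, Set.mem_image]
    constructor
    · rintro ⟨h1, h2⟩
      push_cast at h2
      have he : Even n := by
        have : Even (n ^ 2) := ⟨2 * k, by linarith⟩
        exact (Int.even_pow.mp this).1
      obtain ⟨p, rfl⟩ := he.two_dvd
      refine ⟨p, ⟨?_, by nlinarith⟩, rfl⟩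
      have hd := Int.modEq_iff_dvd.mp (h1.trans hi.symm)
      rw [← mul_sub] at hd
      exact Int.modEq_iff_dvd.mpr
        ((Int.isCoprime_two_right.mpr hl).dvd_of_dvd_mul_left hd)
    · rintro ⟨p, ⟨h1, h2⟩, rfl⟩
      exact ⟨(h1.mul_left 2).trans hi, by push_cast; rw [← h2]; ring⟩
  rw [this, Set.ncard_image_of_injective _ (mul_right_injective₀ two_ne_zero)]

theorem coeff_theta_of_not_square_mod_eight {l i : ℤ} {k : ℕ} (h4 : ¬ 4 ∣ k) (h8 : k % 8 ≠ 1) :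
    PowerSeries.coeff k (theta l i) = 0 := by
  simp only [theta, PowerSeries.coeff_mk]
  have : {n : ℤ | n ≡ i [ZMOD l] ∧ n ^ 2 = (k : ℤ)} = ∅ := by
    refine Set.eq_empty_iff_forall_notMem.mpr fun n ⟨_, hn⟩ => ?_
    rcases Int.even_or_odd n with he | ho
    · obtain ⟨p, rfl⟩ := he.two_dvd
      have : (k : ℤ) = 4 * p ^ 2 := by rw [← hn]; ring
      omega
    · have := Int.eight_dvd_sq_sub_one_of_odd ho
      omega
  simp [this]

/-- Every exponent occurring in `f` is congruent to `a` modulo `q`. -/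
def IsHomogeneousMod (q a : ℤ) (f : LaurentSeries (ZMod 2)) : Prop :=
  ∀ n, f.coeff n ≠ 0 → n ≡ a [ZMOD q]

namespace IsHomogeneousMod

variable {q a b : ℤ} {f g : LaurentSeries (ZMod 2)}

theorem mul (hf : IsHomogeneousMod q a f) (hg : IsHomogeneousMod q b g) :
    IsHomogeneousMod q (a + b) (f * g) := by
  intro n hn
  rw [HahnSeries.coeff_mul] at hn
  obtain ⟨p, hp, hne⟩ := Finset.exists_ne_zero_of_sum_ne_zero hn
  rw [← (Finset.mem_antidiagonal.mp hp).2.2]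
  exact (hf _ (left_ne_zero_of_mul hne)).add (hg _ (right_ne_zero_of_mul hne))

theorem coe {f : PowerSeries (ZMod 2)}
    (h : ∀ k : ℕ, PowerSeries.coeff k f ≠ 0 → (k : ℤ) ≡ a [ZMOD q]) :
    IsHomogeneousMod q a (f : LaurentSeries (ZMod 2)) := by
  intro n hn
  rw [PowerSeries.coeff_coe] at hn
  split_ifs at hn with h0
  · exact absurd rfl hn
  · have := h _ hn
    rwa [Int.natAbs_of_nonneg (not_lt.mp h0)] at this

theorem proj_mem (hf : IsHomogeneousMod q a f) (j : ℤ) {R : Subring (LaurentSeries (ZMod 2))}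
    (hR : f ∈ R) : proj q j f ∈ R := by
  by_cases h : a ≡ j [ZMOD q]
  · convert hR
    ext n
    simp only [proj, ite_eq_left_iff]
    intro hn
    by_contra h0
    exact hn ((hf n (Ne.symm h0)).trans h)
  · convert R.zero_mem
    ext n
    simp only [proj, HahnSeries.coeff_zero, ite_eq_right_iff]
    intro hn
    by_contra h0
    exact h ((hf n h0).symm.trans hn)

end IsHomogeneousMod

theorem isHomogeneousMod_proj (q j : ℤ) (f : LaurentSeries (ZMod 2)) :
    IsHomogeneousMod q j (proj q j f) := by
  intro n hn
  by_contra h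
  exact hn (if_neg h)

/-- The projection `p_{q,j}` as an additive homomorphism. -/
noncomputable def projHom (q j : ℤ) : LaurentSeries (ZMod 2) →+ LaurentSeries (ZMod 2) where
  toFun := proj q j
  map_zero' := by ext n; simp [proj]
  map_add' f g := by ext n; simp only [proj, HahnSeries.coeff_add]; split_ifs <;> simp

theorem sum_proj {q : ℕ} (hq : 0 < q) (f : LaurentSeries (ZMod 2)) :
    ∑ a ∈ Finset.range q, proj q a f = f := by
  ext n
  rw [HahnSeries.coeff_sum]
  have hq' : (0 : ℤ) < q := by exact_mod_cast hq
  have h0 := Int.emod_nonneg n hq'.ne'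
  have h1 := Int.emod_lt_of_pos n hq'
  rw [Finset.sum_eq_single (n % q).toNat]
  · refine if_pos ?_
    rw [Int.toNat_of_nonneg h0]
    exact (Int.mod_modEq n q).symm
  · intro a ha hne
    refine if_neg fun h => hne ?_
    have ha : a < q := Finset.mem_range.mp ha
    have : n % q = a := Eq.trans h (Int.emod_eq_of_lt (by omega) (by exact_mod_cast ha))
    omega
  · intro h
    exact absurd (Finset.mem_range.mpr (by omega)) h

/-- The elements of `L` all of whose projections `p_{q,j}` lie in the subring `R`. -/
noncomputable def gradedPart (q : ℕ) (hq : 0 < q) (R : Subring (LaurentSeries (ZMod 2))) :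
    Subring (LaurentSeries (ZMod 2)) where
  carrier := {f | ∀ j, projHom q j f ∈ R}
  zero_mem' j := by simp
  add_mem' hf hg j := by rw [map_add]; exact R.add_mem (hf j) (hg j)
  neg_mem' hf j := by rw [map_neg]; exact R.neg_mem (hf j)
  one_mem' j := by
    refine IsHomogeneousMod.proj_mem (a := 0) (fun n hn => ?_) j R.one_mem
    rw [HahnSeries.coeff_one] at hn
    split_ifs at hn with h
    · rw [h]
    · exact absurd rfl hn
  mul_mem' {f g} hf hg j := by
    rw [← sum_proj hq f, ← sum_proj hq g, Finset.sum_mul_sum, map_sum]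
    refine sum_mem fun a _ => ?_
    rw [map_sum]
    exact sum_mem fun b _ => ((isHomogeneousMod_proj q a f).mul
      (isHomogeneousMod_proj q b g)).proj_mem j (R.mul_mem (hf a) (hg b))

theorem thetaL_mem_Sring {m : ℕ} {l : ℤ} (hl : l = 2 * m + 1) (i : ℤ) :
    thetaL l i ∈ Sring l m := by
  have h0 := Int.emod_nonneg i (by omega : l ≠ 0)
  have h1 := Int.emod_lt_of_pos i (by omega : 0 < l)
  have key : ∀ r : ℤ, 0 ≤ r → r ≤ m → thetaL l r ∈ Sring l m := by
    intro r hr0 hrm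
    rcases hr0.eq_or_lt with rfl | hpos
    · rw [thetaL, theta_zero, map_one]
      exact one_mem _
    · refine Subring.subset_closure ⟨r.toNat, by omega, by omega, ?_⟩
      rw [Int.toNat_of_nonneg hr0]
  by_cases h : i % l ≤ m
  · rw [thetaL, theta_congr (Int.mod_modEq i l).symm]
    exact key _ h0 h
  · have hc : -i ≡ l - i % l [ZMOD l] := by
      have := (Int.mod_modEq i l).symm.neg
      refine this.trans ?_
      simp [Int.ModEq, sub_eq_add_neg]
    rw [thetaL, ← theta_neg, theta_congr hc]
    exact key _ (by omega) (by omega)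

theorem isHomogeneousMod_thetaL_add_pow_four {l i i' : ℤ} (hl : Odd l)
    (hi : 2 * i' ≡ i [ZMOD l]) :
    IsHomogeneousMod 8 1 (thetaL l i + thetaL l i' ^ 4) := by
  rw [thetaL, thetaL, ← map_pow, ← map_add]
  refine IsHomogeneousMod.coe fun k hk => ?_
  by_contra h
  apply hk
  rw [map_add, show 4 = 2 ^ 2 from rfl, PowerSeries.coeff_pow_two_pow]
  split_ifs with h4
  · obtain ⟨k, rfl⟩ := h4
    norm_num only
    rw [coeff_theta_of_four_dvd hl hi, Nat.mul_div_cancel_left _ (by norm_num)]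
    exact CharTwo.add_self_eq_zero _
  · rw [coeff_theta_of_not_square_mod_eight h4 (fun h' => h ?_), add_zero]
    unfold Int.ModEq
    omega

theorem isHomogeneousMod_thetaL_pow_sixteen (l i : ℤ) :
    IsHomogeneousMod 8 0 (thetaL l i ^ 16) := by
  rw [thetaL, ← map_pow]
  refine IsHomogeneousMod.coe fun k hk => ?_
  rw [show 16 = 2 ^ 4 from rfl, PowerSeries.coeff_pow_two_pow] at hk
  split_ifs at hk with h
  · exact Int.modEq_zero_iff_dvd.mpr (by omega)
  · exact absurd rfl hk

theorem thetaL_mem_gradedPart {m : ℕ} {l : ℤ} (hl : l = 2 * m + 1) (i : ℤ) :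
    thetaL l i ∈ gradedPart 8 (by norm_num) (Sring l m) := by
  have hodd : Odd l := ⟨m, hl⟩
  have hhalf : ∀ r : ℤ, 2 * ((m + 1) * r) ≡ r [ZMOD l] := fun r =>
    (Int.modEq_iff_dvd.mpr ⟨-r, by rw [hl]; ring⟩)
  have hS := thetaL_mem_Sring hl
  have hadd : ∀ r : ℤ, thetaL l r + thetaL l ((m + 1) * r) ^ 4 ∈
      gradedPart 8 (by norm_num) (Sring l m) := fun r j =>
    (isHomogeneousMod_thetaL_add_pow_four hodd (hhalf r)).proj_mem j
      (add_mem (hS _) (pow_mem (hS _) 4))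
  have hpow : ∀ r : ℤ, thetaL l r ^ 16 ∈ gradedPart 8 (by norm_num) (Sring l m) := fun r j =>
    (isHomogeneousMod_thetaL_pow_sixteen l r).proj_mem j (pow_mem (hS _) 16)
  have h2 : (2 : LaurentSeries (ZMod 2)) = 0 := by
    have := congrArg (algebraMap (ZMod 2) (LaurentSeries (ZMod 2))) (show (2 : ZMod 2) = 0 from rfl)
    simpa only [map_ofNat, map_zero] using this
  set b := thetaL l ((m + 1) * i)
  set c := thetaL l ((m + 1) * ((m + 1) * i))
  have : thetaL l i = (thetaL l i + b ^ 4) + (b + c ^ 4) ^ 4 + c ^ 16 := by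
    linear_combination (-(b ^ 4 + 2 * b ^ 3 * c ^ 4 + 3 * b ^ 2 * c ^ 8 + 2 * b * c ^ 12
      + c ^ 16)) * h2
  rw [this]
  exact add_mem (add_mem (hadd i) (pow_mem (hadd _) 4)) (hpow _)

theorem stmt1 (m : ℕ) (hm : 0 < m) (l : ℤ) (hl : l = 2 * m + 1) (j : ℤ)
    (hj0 : 0 ≤ j) (hj8 : j < 8) (f : LaurentSeries (ZMod 2)) (hf : f ∈ Sring l m) :
    proj 8 j f ∈ Sring l m := by
  have : Sring l m ≤ gradedPart 8 (by norm_num) (Sring l m) := by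
    refine Subring.closure_le.mpr ?_
    rintro _ ⟨i, -, -, rfl⟩
    exact thetaL_mem_gradedPart hl i
  exact this hf j
end

section
/- Let l = 3 and a = [1] = ∑_{n ≢ 0 (mod 3)} x^{n²} ∈ ℤ/2[[x]]. If n is an even integer lying in B(a), then n/2 is a perfect square. -/
open scoped Classical

/-- In characteristic two, a swap-invariant sum of products only sees the diagonal. -/
theorem sum_mul_eq_zero_of_swap_mem {α R : Type*} [CommRing R] [CharP R 2] (f : α → R)
    (s : Finset (α × α)) (hs : ∀ p ∈ s, p.swap ∈ s) (hd : ∀ a, (a, a) ∈ s → f a = 0) :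
    ∑ p ∈ s, f p.1 * f p.2 = 0 := by
  refine Finset.sum_involution (fun p _ => p.swap) ?_ ?_ hs fun p _ => Prod.swap_swap p
  · intro p _
    rw [Prod.fst_swap, Prod.snd_swap, mul_comm (f p.2)]
    exact CharTwo.add_self_eq_zero _
  · rintro ⟨i, j⟩ hp hne h
    obtain rfl : j = i := congrArg Prod.fst h
    exact hne (by rw [hd j hp, zero_mul])

theorem coeff_mul_self_of_odd (f : LaurentSeries (ZMod 2)) {n : ℤ} (hn : ¬ 2 ∣ n) :
    (f * f).coeff n = 0 := by
  rw [HahnSeries.coeff_mul]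
  refine sum_mul_eq_zero_of_swap_mem f.coeff _ ?_ ?_
  · rintro ⟨i, j⟩ hp
    simp only [Finset.mem_antidiagonal, Prod.swap_prod_mk] at hp ⊢
    exact ⟨hp.2.1, hp.1, by omega⟩
  · intro a ha
    simp only [Finset.mem_antidiagonal] at ha
    omega

theorem coeff_mul_self_two_mul (f : LaurentSeries (ZMod 2)) (m : ℤ) :
    (f * f).coeff (2 * m) = f.coeff m := by
  have sq (x : ZMod 2) : x * x = x := by revert x; decide
  rw [HahnSeries.coeff_mul, ← Finset.sum_filter_add_sum_filter_not _ (fun p => p = (m, m)),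
    sum_mul_eq_zero_of_swap_mem f.coeff (Finset.filter (fun p => ¬ p = (m, m)) _), add_zero,
    Finset.sum_filter, Finset.sum_ite_eq', sq]
  · split_ifs with h
    · rfl
    · by_contra hm
      exact h (Finset.mem_antidiagonal.mpr ⟨Ne.symm hm, Ne.symm hm, (two_mul m).symm⟩)
  · rintro ⟨i, j⟩ hp
    simp only [Finset.mem_filter, Finset.mem_antidiagonal, Prod.swap_prod_mk,
      Prod.mk.injEq] at hp ⊢
    exact ⟨⟨hp.1.2.1, hp.1.1, by omega⟩, by omega⟩
  · intro a ha
    simp only [Finset.mem_filter, Finset.mem_antidiagonal, Prod.mk.injEq] at ha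
    omega

theorem coeff_thetaL (l i k : ℤ) :
    (thetaL l i).coeff k = (({n : ℤ | n ≡ i [ZMOD l] ∧ n ^ 2 = k}.ncard : ℕ) : ZMod 2) := by
  rw [thetaL, PowerSeries.coeff_coe]
  split_ifs with h
  · have : {n : ℤ | n ≡ i [ZMOD l] ∧ n ^ 2 = k} = ∅ := by
      ext n
      simp only [Set.mem_ofPred_eq, Set.mem_empty_iff_false, iff_false, not_and]
      intro _ hn
      nlinarith [sq_nonneg n]
    simp [this]
  · rw [theta, PowerSeries.coeff_mk, Int.natCast_natAbs, abs_of_nonneg (not_lt.mp h)]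

theorem exists_sq_of_coeff_thetaL_ne_zero {l i k : ℤ} (h : (thetaL l i).coeff k ≠ 0) :
    ∃ n : ℤ, k = n ^ 2 := by
  rw [coeff_thetaL] at h
  obtain ⟨n, hn⟩ := Set.nonempty_of_ncard_ne_zero (fun h0 => h (by rw [h0, Nat.cast_zero]))
  exact ⟨n, hn.2.symm⟩

theorem coeff_thetaL_three_one_four_mul (k : ℤ) :
    (thetaL 3 1).coeff (4 * k) = (thetaL 3 1).coeff k := by
  rw [coeff_thetaL, coeff_thetaL]
  have : {n : ℤ | n ≡ 1 [ZMOD 3] ∧ n ^ 2 = 4 * k} =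
      (fun n => -2 * n) '' {n : ℤ | n ≡ 1 [ZMOD 3] ∧ n ^ 2 = k} := by
    ext n
    simp only [Set.mem_ofPred_eq, Set.mem_image, Int.ModEq]
    constructor
    · rintro ⟨h1, h2⟩
      have : (2 : ℤ) ∣ n := Int.prime_two.dvd_of_dvd_pow (n := 2) ⟨2 * k, by linarith⟩
      obtain ⟨m, rfl⟩ := this
      exact ⟨-m, ⟨by omega, by linarith⟩, by ring⟩
    · rintro ⟨m, ⟨h1, h2⟩, rfl⟩
      exact ⟨by omega, by rw [← h2]; ring⟩
  rw [this, Set.ncard_image_of_injective _ (fun a b h => by simpa using h)]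

/-- The even part of `[1]` is `[1]⁴` when `l = 3`. -/
theorem coeff_thetaL_three_one_sub_pow_four {n : ℤ} (hn : 2 ∣ n) :
    (thetaL 3 1 - thetaL 3 1 * thetaL 3 1 * (thetaL 3 1 * thetaL 3 1)).coeff n = 0 := by
  obtain ⟨m, rfl⟩ := hn
  rw [HahnSeries.coeff_sub, coeff_mul_self_two_mul, sub_eq_zero]
  by_cases hm : 2 ∣ m
  · obtain ⟨k, rfl⟩ := hm
    rw [coeff_mul_self_two_mul, ← coeff_thetaL_three_one_four_mul k,
      show 2 * (2 * k) = 4 * k by ring]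
  · rw [coeff_mul_self_of_odd _ hm]
    by_contra h
    obtain ⟨r, hr⟩ := exists_sq_of_coeff_thetaL_ne_zero h
    obtain ⟨s, rfl⟩ : (2 : ℤ) ∣ r := Int.prime_two.dvd_of_dvd_pow (n := 2) ⟨m, hr.symm⟩
    exact hm ⟨s ^ 2, by linarith⟩

theorem coeff_mul_mul_self_of_even {f : LaurentSeries (ZMod 2)}
    (hf : ∀ n : ℤ, 2 ∣ n → f.coeff n = 0) (g : LaurentSeries (ZMod 2)) {n : ℤ} (hn : 2 ∣ n) :
    (f * (g * g)).coeff n = 0 := by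
  rw [HahnSeries.coeff_mul]
  refine Finset.sum_eq_zero fun p hp => ?_
  rw [Finset.mem_antidiagonal] at hp
  by_cases h : 2 ∣ p.2
  · rw [hf p.1 (by omega), zero_mul]
  · rw [coeff_mul_self_of_odd g h, mul_zero]

theorem stmt2 (n : ℤ) (hn2 : 2 ∣ n) (hnB : n ∈ Bset (theta 3 1)) :
    ∃ k : ℤ, n = 2 * k ^ 2 := by
  have hB : ((thetaL 3 1)⁻¹).coeff n = 1 := hnB
  have ha : thetaL 3 1 ≠ 0 := by
    intro h
    rw [h, inv_zero, HahnSeries.coeff_zero] at hB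
    exact zero_ne_one hB
  have key : (thetaL 3 1)⁻¹ = thetaL 3 1 * thetaL 3 1 +
      (thetaL 3 1 - thetaL 3 1 * thetaL 3 1 * (thetaL 3 1 * thetaL 3 1)) *
        ((thetaL 3 1)⁻¹ * (thetaL 3 1)⁻¹) := by
    field_simp
    ring
  rw [key, HahnSeries.coeff_add,
    coeff_mul_mul_self_of_even (fun _ h => coeff_thetaL_three_one_sub_pow_four h) _ hn2,
    add_zero] at hB
  obtain ⟨m, rfl⟩ := hn2
  rw [coeff_mul_self_two_mul] at hB
  obtain ⟨k, rfl⟩ := exists_sq_of_coeff_thetaL_ne_zero (hB ▸ one_ne_zero)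
  exact ⟨k, rfl⟩
end

section
/- Let l = 3 and a = [1]. Suppose n ≡ 1 (mod 4) and n ∈ B(a). Then the number of ordered pairs (s₁, s₂) of perfect squares (nonnegative integers that are squares) with s₁ + 4s₂ = n is odd; moreover, n is the product of a prime and a perfect square. -/
open scoped Classical

/-- A self-map of a finite set that squares to the identity preserves the parity of the
cardinality when passing to its fixed points. -/
theorem card_eq_card_fixed_of_involution {α : Type*} [DecidableEq α] (s : Finset α)
    (f : α → α)
    (hf : ∀ x ∈ s, f x ∈ s) (hff : ∀ x ∈ s, f (f x) = x) :
    ((s.card : ℕ) : ZMod 2) = ((s.filter fun x => f x = x).card : ℕ) := by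
  have h : ∑ x ∈ s with ¬ f x = x, (1 : ZMod 2) = 0 := by
    refine Finset.sum_involution (fun x _ => f x) (fun _ _ => by decide) ?_ ?_ ?_
    · intro x hx _
      exact (Finset.mem_filter.1 hx).2
    · intro x hx
      rw [Finset.mem_filter] at hx ⊢
      refine ⟨hf x hx.1, fun h => hx.2 ?_⟩
      rw [hff x hx.1] at h
      exact h.symm
    · intro x hx
      exact hff x (Finset.mem_filter.1 hx).1
  rw [← Finset.card_filter_add_card_filter_not (s := s) (fun x => f x = x)]
  simp only [Finset.sum_const, nsmul_eq_mul, mul_one] at h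
  rw [Nat.cast_add, h, add_zero]

theorem zmod_two_eq_one_iff (a : ZMod 2) : a = 1 ↔ a ≠ 0 := by
  revert a; decide

theorem coeff_sq_two_mul (f : LaurentSeries (ZMod 2)) (n : ℤ) :
    (f ^ 2).coeff (2 * n) = f.coeff n := by
  have key : ∀ s : Finset (ℤ × ℤ), (∀ x, x ∈ s ↔ f.coeff x.1 ≠ 0 ∧ f.coeff x.2 ≠ 0 ∧
      x.1 + x.2 = 2 * n) → ∑ x ∈ s, f.coeff x.1 * f.coeff x.2 = f.coeff n := by
    intro s hs
    have h1 : ∀ x ∈ s, f.coeff x.1 * f.coeff x.2 = 1 := by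
      intro x hx
      obtain ⟨h1, h2, -⟩ := (hs x).1 hx
      rw [(zmod_two_eq_one_iff _).2 h1, (zmod_two_eq_one_iff _).2 h2, one_mul]
    rw [Finset.sum_congr rfl h1, Finset.sum_const, nsmul_eq_mul, mul_one,
      card_eq_card_fixed_of_involution s Prod.swap
        (fun x hx => by
          obtain ⟨h1, h2, h3⟩ := (hs x).1 hx
          exact (hs _).2 ⟨h2, h1, by simpa [add_comm] using h3⟩)
        (fun x _ => Prod.swap_swap x)]
    by_cases hn : f.coeff n = 0
    · rw [hn, Finset.filter_eq_empty_iff.2, Finset.card_empty, Nat.cast_zero]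
      intro x hx hxx
      obtain ⟨h1, h2, h3⟩ := (hs x).1 hx
      have h4 : x.2 = x.1 := congrArg Prod.fst hxx
      have h5 : x.1 = n := by lia
      exact h1 (h5 ▸ hn)
    · have : (s.filter fun x => x.swap = x) = {(n, n)} := by
        ext ⟨a, b⟩
        simp only [Finset.mem_filter, hs, Finset.mem_singleton, Prod.swap_prod_mk, Prod.mk.injEq]
        constructor
        · rintro ⟨⟨-, -, h⟩, h', -⟩
          constructor <;> lia
        · rintro ⟨rfl, rfl⟩
          exact ⟨⟨hn, hn, by ring⟩, rfl, rfl⟩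
      rw [this, Finset.card_singleton, Nat.cast_one, (zmod_two_eq_one_iff _).2 hn]
  rw [sq, HahnSeries.coeff_mul]
  exact key _ fun x => Finset.mem_antidiagonal

theorem coeff_sq_of_odd (f : LaurentSeries (ZMod 2)) {n : ℤ} (hn : Odd n) :
    (f ^ 2).coeff n = 0 := by
  rw [sq, HahnSeries.coeff_mul]
  refine Finset.sum_involution (fun x _ => x.swap) ?_ ?_ ?_ ?_
  · intro x _
    rw [Prod.fst_swap, Prod.snd_swap, mul_comm (f.coeff x.2), CharTwo.add_self_eq_zero]
  · intro x hx _ hxx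
    have h3 : x.1 + x.2 = n := (Finset.mem_antidiagonal.1 hx).2.2
    have h4 : x.2 = x.1 := congrArg Prod.fst hxx
    obtain ⟨k, hk⟩ := hn
    lia
  · intro x hx
    obtain ⟨h1, h2, h3⟩ := Finset.mem_antidiagonal.1 hx
    exact Finset.mem_antidiagonal.2 ⟨h2, h1, by rw [← h3]; exact add_comm _ _⟩
  · intro x _
    exact x.swap_swap

theorem coeff_pow_four_mul (f : LaurentSeries (ZMod 2)) (n : ℤ) :
    (f ^ 4).coeff (4 * n) = f.coeff n := by
  rw [show f ^ 4 = (f ^ 2) ^ 2 by ring, show 4 * n = 2 * (2 * n) by ring, coeff_sq_two_mul,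
    coeff_sq_two_mul]

theorem coeff_pow_four_eq_zero (f : LaurentSeries (ZMod 2)) {n : ℤ} (hn : ¬ 4 ∣ n) :
    (f ^ 4).coeff n = 0 := by
  rw [show f ^ 4 = (f ^ 2) ^ 2 by ring]
  obtain ⟨k, hk⟩ | h := Int.even_or_odd n
  · have h2 : n = 2 * k := by lia
    rw [h2, coeff_sq_two_mul]
    refine coeff_sq_of_odd f (Int.not_even_iff_odd.1 ?_)
    rintro ⟨m, hm⟩
    exact hn ⟨m, by lia⟩
  · exact coeff_sq_of_odd _ h

/-- If `f` and `g` are supported in the residue classes `i` and `j` modulo `4`, then `f * g` is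
supported in the class `i + j`. -/
theorem coeff_mul_eq_zero_of_residue {f g : LaurentSeries (ZMod 2)} {i j : ℤ}
    (hf : ∀ n, f.coeff n ≠ 0 → n % 4 = i) (hg : ∀ n, g.coeff n ≠ 0 → n % 4 = j) (n : ℤ)
    (hn : (f * g).coeff n ≠ 0) : n % 4 = (i + j) % 4 := by
  rw [HahnSeries.coeff_mul] at hn
  obtain ⟨x, hx, -⟩ := Finset.exists_ne_zero_of_sum_ne_zero hn
  obtain ⟨h1, h2, h3⟩ := Finset.mem_antidiagonal.1 hx
  have h4 := hf _ h1
  have h5 := hg _ h2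
  lia

theorem coeff_thetaL_three_one_ne_zero_iff (n : ℤ) :
    (thetaL 3 1).coeff n ≠ 0 ↔ ∃ m : ℤ, ¬ 3 ∣ m ∧ m ^ 2 = n := by
  rw [thetaL, PowerSeries.coeff_coe]
  split_ifs with hn
  · simp only [ne_eq, not_true_eq_false, false_iff, not_exists, not_and]
    rintro m - rfl
    exact absurd hn (sq_nonneg m).not_gt
  · rw [theta, PowerSeries.coeff_mk, Int.natAbs_of_nonneg (not_lt.1 hn)]
    constructor
    · intro h
      have h0 : {m : ℤ | m ≡ 1 [ZMOD 3] ∧ m ^ 2 = n}.ncard ≠ 0 := by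
        intro h0
        rw [h0] at h
        exact h rfl
      obtain ⟨m, h1, h2⟩ := Set.nonempty_of_ncard_ne_zero h0
      exact ⟨m, by rw [Int.ModEq] at h1; lia, h2⟩
    · rintro ⟨m, h3, rfl⟩
      obtain ⟨k, hk, hkm⟩ : ∃ k : ℤ, k % 3 = 1 ∧ m ^ 2 = k ^ 2 := by
        by_cases h1 : m % 3 = 1
        · exact ⟨m, h1, rfl⟩
        · exact ⟨-m, by lia, by ring⟩
      have : {j : ℤ | j ≡ 1 [ZMOD 3] ∧ j ^ 2 = m ^ 2} = {k} := by
        ext j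
        simp only [Set.mem_ofPred_eq, Set.mem_singleton_iff, Int.ModEq, hkm, sq_eq_sq_iff_eq_or_eq_neg]
        lia
      rw [this, Set.ncard_singleton]
      decide

theorem coeff_thetaL_pow_four_ne_zero_iff (n : ℤ) :
    (thetaL 3 1 ^ 4).coeff n ≠ 0 ↔ ∃ m : ℤ, ¬ 3 ∣ m ∧ 4 * m ^ 2 = n := by
  by_cases h : 4 ∣ n
  · obtain ⟨k, rfl⟩ := h
    rw [coeff_pow_four_mul, coeff_thetaL_three_one_ne_zero_iff]
    exact exists_congr fun m => and_congr_right fun _ => by lia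
  · simp only [coeff_pow_four_eq_zero _ h, ne_eq, not_true_eq_false, false_iff, not_exists, not_and]
    rintro m - rfl
    exact h ⟨_, rfl⟩

/-- Modulo `2`, subtracting the fourth power of `[1]` leaves the odd squares prime to `3`. -/
theorem coeff_thetaL_add_pow_four_ne_zero_iff (n : ℤ) :
    (thetaL 3 1 + thetaL 3 1 ^ 4).coeff n ≠ 0 ↔ ∃ m : ℤ, Odd m ∧ ¬ 3 ∣ m ∧ m ^ 2 = n := by
  have h2 : ∀ a b : ZMod 2, a + b ≠ 0 ↔ ((a ≠ 0 ∧ ¬ b ≠ 0) ∨ (¬ a ≠ 0 ∧ b ≠ 0)) := by decide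
  rw [HahnSeries.coeff_add, h2, coeff_thetaL_three_one_ne_zero_iff,
    coeff_thetaL_pow_four_ne_zero_iff]
  constructor
  · rintro (⟨⟨m, h3, rfl⟩, h⟩ | ⟨h, m, h3, rfl⟩)
    · refine ⟨m, Int.not_even_iff_odd.1 ?_, h3, rfl⟩
      rintro ⟨k, rfl⟩
      exact h ⟨k, by lia, by ring⟩
    · exact absurd ⟨2 * m, by lia, by ring⟩ h
  · rintro ⟨m, hm, h3, rfl⟩
    refine Or.inl ⟨⟨m, h3, rfl⟩, ?_⟩
    rintro ⟨k, -, hk⟩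
    have := hm.pow (n := 2)
    rw [← hk] at this
    exact Int.not_even_iff_odd.2 this ⟨2 * k ^ 2, by ring⟩

theorem laurentSeries_two_eq_zero : (2 : LaurentSeries (ZMod 2)) = 0 := by
  have h := map_ofNat (HahnSeries.C : ZMod 2 →+* LaurentSeries (ZMod 2)) 2
  rw [← h, show (OfNat.ofNat 2 : ZMod 2) = 0 from rfl, map_zero]

theorem coeff_inv_thetaL_three_one {n : ℤ} (hn : n % 4 = 1) :
    ((thetaL 3 1)⁻¹).coeff n =
      ((thetaL 3 1 + thetaL 3 1 ^ 4) * thetaL 3 1 ^ 4).coeff n := by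
  set A := thetaL 3 1 with hA
  set O := A + A ^ 4 with hO
  have hA0 : A ≠ 0 := by
    intro h0
    have := (coeff_thetaL_three_one_ne_zero_iff 1).2 ⟨1, by decide, by norm_num⟩
    rw [← hA, h0] at this
    exact this rfl
  have hAO : A = A ^ 4 + O := by
    rw [hO, ← sub_eq_zero]
    linear_combination (-A ^ 4) * laurentSeries_two_eq_zero
  have h4 : ∀ (f : LaurentSeries (ZMod 2)) (k : ℤ), (f ^ 4).coeff k ≠ 0 → k % 4 = 0 := by
    intro f k h
    by_contra h'
    exact h (coeff_pow_four_eq_zero f (by lia))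
  have hO1 : ∀ k : ℤ, O.coeff k ≠ 0 → k % 4 = 1 := by
    intro k h
    obtain ⟨m, ⟨j, rfl⟩, -, rfl⟩ := (coeff_thetaL_add_pow_four_ne_zero_iff k).1 h
    ring_nf
    lia
  have expand : A⁻¹ = O * A ^ 4 + ((A ^ 2) ^ 4 + O ^ 2 + O * O * O * A⁻¹ ^ 4) := by
    have hsq : A ^ 2 = A ^ 8 + O ^ 2 := by
      rw [hO]
      linear_combination
        (-A ^ 8 - A ^ 5) * laurentSeries_two_eq_zero
    have h1 : A⁻¹ = A * A ^ 2 * A⁻¹ ^ 4 := by field_simp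
    have h2 : A ^ 4 * A⁻¹ ^ 4 = 1 := by field_simp
    calc A⁻¹ = A * A ^ 2 * A⁻¹ ^ 4 := h1
      _ = (A ^ 4 + O) * (A ^ 8 + O ^ 2) * A⁻¹ ^ 4 := by rw [← hsq, ← hAO]
      _ = _ := by linear_combination (O * A ^ 4 + A ^ 8 + O ^ 2) * h2
  have hz1 : ((A ^ 2) ^ 4).coeff n = 0 := by
    by_contra h
    have := h4 _ _ h
    lia
  have hz2 : (O ^ 2).coeff n = 0 := coeff_sq_of_odd _ ⟨n / 2, by lia⟩
  have hz3 : (O * O * O * A⁻¹ ^ 4).coeff n = 0 := by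
    by_contra h
    have := coeff_mul_eq_zero_of_residue (coeff_mul_eq_zero_of_residue
      (coeff_mul_eq_zero_of_residue hO1 hO1) hO1) (h4 A⁻¹) n h
    lia
  rw [expand, HahnSeries.coeff_add, HahnSeries.coeff_add, HahnSeries.coeff_add, hz1, hz2, hz3,
    add_zero, add_zero, add_zero]

theorem odd_ncard_of_mem_Bset {n : ℤ} (hn : n % 4 = 1) (hnB : n ∈ Bset (theta 3 1)) :
    n % 3 = 2 ∧ Odd ({p : ℕ × ℕ | (∃ a : ℕ, p.1 = a ^ 2) ∧ (∃ b : ℕ, p.2 = b ^ 2) ∧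
        (p.1 : ℤ) + 4 * (p.2 : ℤ) = n}.ncard) := by
  have hsq : ∀ k : ℤ, ¬ 3 ∣ k ↔ k ^ 2 % 3 = 1 := by
    intro k
    rw [sq, Int.mul_emod]
    have : k % 3 = 0 ∨ k % 3 = 1 ∨ k % 3 = 2 := by lia
    rcases this with h | h | h <;> rw [h] <;> norm_num <;> lia
  have hsq' : ∀ k : ℤ, k ^ 2 % 3 = 0 ∨ k ^ 2 % 3 = 1 := by
    intro k
    by_cases h : 3 ∣ k
    · left
      obtain ⟨j, rfl⟩ := h
      exact Int.emod_eq_zero_of_dvd ⟨3 * j ^ 2, by ring⟩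
    · exact Or.inr ((hsq k).1 h)
  have h1 : ((thetaL 3 1)⁻¹).coeff n = 1 := hnB
  rw [coeff_inv_thetaL_three_one hn, HahnSeries.coeff_mul] at h1
  obtain ⟨s, hs, hsum⟩ : ∃ s : Finset (ℤ × ℤ), (∀ x, x ∈ s ↔
      (∃ m : ℤ, Odd m ∧ ¬ 3 ∣ m ∧ m ^ 2 = x.1) ∧ (∃ m : ℤ, ¬ 3 ∣ m ∧ 4 * m ^ 2 = x.2) ∧
        x.1 + x.2 = n) ∧ ((s.card : ℕ) : ZMod 2) = 1 := by
    refine ⟨Finset.antidiagonal (thetaL 3 1 + thetaL 3 1 ^ 4).isPWO_support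
      (thetaL 3 1 ^ 4).isPWO_support n, fun x => ?_, ?_⟩
    rotate_left
    · rw [← h1, Finset.card_eq_sum_ones, Nat.cast_sum, Nat.cast_one]
      refine Finset.sum_congr rfl fun x hx => ?_
      obtain ⟨h1, h2, -⟩ := Finset.mem_antidiagonal.1 hx
      rw [(zmod_two_eq_one_iff _).2 h1, (zmod_two_eq_one_iff _).2 h2, one_mul]
    · rw [Finset.mem_antidiagonal, ← coeff_thetaL_add_pow_four_ne_zero_iff,
        ← coeff_thetaL_pow_four_ne_zero_iff]
      rfl
  have hodd : Odd s.card := (ZMod.natCast_eq_one_iff_odd).1 hsum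
  have hn3 : n % 3 = 2 := by
    obtain ⟨x, hx⟩ := Finset.card_pos.1 hodd.pos
    obtain ⟨⟨m, -, h3, hm⟩, ⟨k, h3', hk⟩, h⟩ := (hs x).1 hx
    have := (hsq m).1 h3
    have := (hsq k).1 h3'
    lia
  refine ⟨hn3, ?_⟩
  have hinj : Function.Injective fun p : ℕ × ℕ => ((p.1 : ℤ), 4 * (p.2 : ℤ)) := by
    rintro ⟨a, b⟩ ⟨c, d⟩ h
    simp only [Prod.mk.injEq] at h ⊢
    lia
  rw [← Set.ncard_image_of_injective _ hinj]
  convert hodd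
  rw [← Set.ncard_coe_finset]
  congr 1
  ext ⟨x, y⟩
  simp only [Set.mem_image, Set.mem_ofPred_eq, Finset.mem_coe, hs, Prod.mk.injEq, Prod.exists]
  constructor
  · rintro ⟨_, _, ⟨⟨a, rfl⟩, ⟨b, rfl⟩, h⟩, rfl, rfl⟩
    push_cast at h ⊢
    have ha := hsq' a
    have hb := hsq' b
    refine ⟨⟨a, Int.not_even_iff_odd.1 ?_, (hsq _).2 (by lia), rfl⟩,
      ⟨b, (hsq _).2 (by lia), rfl⟩, h⟩
    rintro ⟨c, hc⟩
    rw [hc] at h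
    ring_nf at h
    lia
  · rintro ⟨⟨a, -, -, rfl⟩, ⟨b, -, rfl⟩, h⟩
    exact ⟨a.natAbs ^ 2, b.natAbs ^ 2, ⟨⟨_, rfl⟩, ⟨_, rfl⟩, by simpa using h⟩, by simp, by simp⟩

/-- Zagier's involution on the solutions of `x² + 4yz = n`. -/
def zagierInvolution (t : ℤ × ℤ × ℤ) : ℤ × ℤ × ℤ :=
  if t.1 + t.2.2 < t.2.1 then (t.1 + 2 * t.2.2, t.2.2, t.2.1 - t.1 - t.2.2)
  else if t.1 < 2 * t.2.1 then (2 * t.2.1 - t.1, t.2.1, t.1 - t.2.1 + t.2.2)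
  else (t.1 - 2 * t.2.1, t.1 - t.2.1 + t.2.2, t.2.1)

/-- For a nonsquare `n ≡ 1 (mod 4)`, the number of representations `n = x² + 4y²` with `x, y > 0`
has the same parity as the number of divisors of `n` smaller than `√n`. -/
theorem card_sq_add_four_sq_eq_card_divisors_lt {n : ℤ} (hn : n % 4 = 1)
    (hsq : ∀ k : ℤ, k ^ 2 ≠ n) :
    ((((Finset.Icc 1 n ×ˢ Finset.Icc 1 n).filter fun p : ℤ × ℤ =>
      p.1 ^ 2 + 4 * p.2 ^ 2 = n).card : ℕ) : ZMod 2) =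
    (((Finset.Icc 1 n).filter fun d : ℤ => d ∣ n ∧ d * d < n).card : ℕ) := by
  set S := (Finset.Icc 1 n ×ˢ Finset.Icc 1 n ×ˢ Finset.Icc 1 n).filter fun t : ℤ × ℤ × ℤ =>
    t.1 ^ 2 + 4 * t.2.1 * t.2.2 = n with hS
  have mem : ∀ x y z : ℤ, (x, y, z) ∈ S ↔ 0 < x ∧ 0 < y ∧ 0 < z ∧ x ^ 2 + 4 * y * z = n := by
    intro x y z
    simp only [hS, Finset.mem_filter, Finset.mem_product, Finset.mem_Icc]
    constructor
    · rintro ⟨⟨h1, h2, h3⟩, h⟩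
      exact ⟨by lia, by lia, by lia, h⟩
    · rintro ⟨hx, hy, hz, h⟩
      refine ⟨⟨⟨hx, ?_⟩, ⟨hy, ?_⟩, ⟨hz, ?_⟩⟩, h⟩ <;> nlinarith [mul_pos hy hz]
  have hx2 : ∀ x y z : ℤ, (x, y, z) ∈ S → x ≠ 2 * y := by
    rintro x y z h rfl
    have := ((mem _ _ _).1 h).2.2.2
    ring_nf at this
    lia
  have hxyz : ∀ x y z : ℤ, (x, y, z) ∈ S → x + z ≠ y := by
    rintro x y z h rfl
    refine hsq (x + 2 * z) ?_
    rw [← ((mem _ _ _).1 h).2.2.2]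
    ring
  have swap := card_eq_card_fixed_of_involution S (fun t => (t.1, t.2.2, t.2.1))
    (by
      rintro ⟨x, y, z⟩ h
      rw [mem] at h ⊢
      exact ⟨h.1, h.2.2.1, h.2.1, by linarith [h.2.2.2]⟩)
    (fun _ _ => rfl)
  have zagier := card_eq_card_fixed_of_involution S zagierInvolution
    (by
      rintro ⟨x, y, z⟩ h
      have h1 := hx2 _ _ _ h
      have h2 := hxyz _ _ _ h
      rw [mem] at h
      obtain ⟨hx, hy, hz, h⟩ := h
      simp only [zagierInvolution]
      split_ifs <;> rw [mem] <;> refine ⟨by lia, by lia, by lia, ?_⟩ <;> rw [← h] <;> ring)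
    (by
      rintro ⟨x, y, z⟩ h
      have h1 := hx2 _ _ _ h
      have h2 := hxyz _ _ _ h
      rw [mem] at h
      obtain ⟨hx, hy, hz, h⟩ := h
      simp only [zagierInvolution]
      split_ifs <;> simp only [Prod.mk.injEq] <;> lia)
  have e1 : (S.filter fun t => (t.1, t.2.2, t.2.1) = t).card =
      ((Finset.Icc 1 n ×ˢ Finset.Icc 1 n).filter fun p : ℤ × ℤ =>
        p.1 ^ 2 + 4 * p.2 ^ 2 = n).card := by
    refine Finset.card_bij' (fun t _ => (t.1, t.2.1)) (fun p _ => (p.1, p.2, p.2)) ?_ ?_ ?_ ?_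
    · rintro ⟨x, y, z⟩ h
      simp only [hS, Finset.mem_filter, Finset.mem_product, Prod.mk.injEq] at h ⊢
      obtain ⟨⟨⟨h1, h2, h3⟩, h⟩, -, rfl, -⟩ := h
      exact ⟨⟨h1, h2⟩, by rw [← h]; ring⟩
    · rintro ⟨x, y⟩ h
      simp only [hS, Finset.mem_filter, Finset.mem_product] at h ⊢
      obtain ⟨⟨h1, h2⟩, h⟩ := h
      exact ⟨⟨⟨h1, h2, h2⟩, by rw [← h]; ring⟩, trivial⟩
    · rintro ⟨x, y, z⟩ h
      have := (Finset.mem_filter.1 h).2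
      simp only [Prod.mk.injEq] at this ⊢
      exact ⟨trivial, trivial, this.2.2⟩
    · rintro ⟨x, y⟩ _
      rfl
  have e2 : (S.filter fun t => zagierInvolution t = t).card =
      ((Finset.Icc 1 n).filter fun d : ℤ => d ∣ n ∧ d * d < n).card := by
    have fixed : ∀ x y z : ℤ, (x, y, z) ∈ S.filter (fun t => zagierInvolution t = t) ↔
        (x, y, z) ∈ S ∧ x = y := by
      intro x y z
      rw [Finset.mem_filter]
      refine and_congr_right fun h => ?_
      rw [mem] at h
      simp only [zagierInvolution]
      split_ifs <;> simp only [Prod.mk.injEq] <;> lia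
    refine Finset.card_bij' (fun t _ => t.1) (fun d _ => (d, d, (n / d - d) / 4)) ?_ ?_ ?_ ?_
    · rintro ⟨x, y, z⟩ h
      rw [fixed, mem] at h
      obtain ⟨⟨hx, hy, hz, h⟩, rfl⟩ := h
      have := mul_pos hx hz
      simp only [Finset.mem_filter, Finset.mem_Icc]
      exact ⟨⟨by lia, by nlinarith⟩, ⟨x + 4 * z, by rw [← h]; ring⟩, by nlinarith⟩
    · intro d h
      simp only [Finset.mem_filter, Finset.mem_Icc] at h
      obtain ⟨⟨h1, h2⟩, ⟨w, rfl⟩, h3⟩ := h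
      rw [Int.mul_ediv_cancel_left _ (by lia), fixed, mem]
      have hw : d < w := lt_of_mul_lt_mul_left h3 (by lia)
      have h4 : (w - d) % 4 = 0 := by
        rw [Int.mul_emod] at hn
        have : d % 4 = 0 ∨ d % 4 = 1 ∨ d % 4 = 2 ∨ d % 4 = 3 := by lia
        rcases this with h | h | h | h <;> rw [h] at hn <;> lia
      obtain ⟨k, hk⟩ := Int.dvd_of_emod_eq_zero h4
      have hwk : w = d + 4 * k := by lia
      subst hwk
      rw [hk, Int.mul_ediv_cancel_left _ (by norm_num)]
      exact ⟨⟨by lia, by lia, by lia, by ring⟩, rfl⟩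
    · rintro ⟨x, y, z⟩ h
      rw [fixed, mem] at h
      obtain ⟨⟨hx, hy, hz, h⟩, rfl⟩ := h
      have h' : n = x * (x + 4 * z) := by rw [← h]; ring
      simp only [Prod.mk.injEq, true_and]
      rw [h', Int.mul_ediv_cancel_left _ hx.ne']
      lia
    · intro d _
      rfl
  rw [← e1, ← e2, ← swap, ← zagier]

/-- A nonsquare number has twice as many divisors as it has divisors below its square root. -/
theorem card_divisors_eq_two_mul {n : ℕ} (hsq : ∀ k : ℕ, k ^ 2 ≠ n) :
    n.divisors.card = 2 * (n.divisors.filter fun d => d * d < n).card := by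
  rw [← Finset.card_filter_add_card_filter_not (s := n.divisors) (fun d => d * d < n), two_mul]
  congr 1
  have key : ∀ d ∈ n.divisors, n / d ∈ n.divisors ∧ n / (n / d) = d ∧
      (¬ d * d < n ↔ n / d * (n / d) < n) := by
    intro d hd
    obtain ⟨⟨w, rfl⟩, h0⟩ := Nat.mem_divisors.1 hd
    have hd0 : 0 < d := by grind
    have hw0 : 0 < w := by grind
    have hne : d ≠ w := fun h => hsq d (by rw [h]; ring)
    rw [Nat.mul_div_cancel_left _ hd0, Nat.mul_div_cancel _ hw0,
      Nat.mul_lt_mul_left hd0, Nat.mul_lt_mul_right hw0]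
    exact ⟨Nat.mem_divisors.2 ⟨Dvd.intro_left d rfl, h0⟩, rfl, by lia⟩
  refine Finset.card_bij' (fun d _ => n / d) (fun d _ => n / d) ?_ ?_ ?_ ?_
  · intro d hd
    rw [Finset.mem_filter] at hd ⊢
    obtain ⟨h1, h2, h3⟩ := key d hd.1
    exact ⟨h1, h3.1 hd.2⟩
  · intro d hd
    rw [Finset.mem_filter] at hd ⊢
    obtain ⟨h1, h2, h3⟩ := key d hd.1
    obtain ⟨-, -, h4⟩ := key _ h1
    rw [h2] at h4
    exact ⟨h1, h4.2 hd.2⟩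
  · intro d hd
    exact (key d (Finset.mem_filter.1 hd).1).2.1
  · intro d hd
    exact (key d (Finset.mem_filter.1 hd).1).2.1

/-- A nonsquare number whose number of divisors is not divisible by `4` is a prime times a
square. -/
theorem exists_prime_mul_sq_of_not_four_dvd_card_divisors {n : ℕ} (hsq : ∀ k : ℕ, k ^ 2 ≠ n)
    (h4 : ¬ 4 ∣ n.divisors.card) : ∃ p : ℕ, p.Prime ∧ ∃ k : ℕ, n = p * k ^ 2 := by
  have hn0 : n ≠ 0 := fun h => hsq 0 (by rw [h]; rfl)
  obtain ⟨a, b, ha, hb, hab, hsf⟩ := Nat.sq_mul_squarefree_of_pos (Nat.pos_of_ne_zero hn0)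
  by_contra hcon
  push Not at hcon
  have ha1 : a ≠ 1 := by
    rintro rfl
    exact hsq b (by lia)
  obtain ⟨p, hp, m, rfl⟩ := Nat.exists_prime_and_dvd ha1
  have hm1 : m ≠ 1 := by
    rintro rfl
    exact hcon p hp b (by rw [← hab]; ring)
  obtain ⟨q, hq, hqm⟩ := Nat.exists_prime_and_dvd hm1
  have hpq : p ≠ q := by
    rintro rfl
    exact hp.one_lt.ne' (Nat.isUnit_iff.1 (hsf p (Nat.mul_dvd_mul_left p hqm)))
  have even_factor : ∀ r : ℕ, r.Prime → r ∣ p * m → 2 ∣ n.factorization r + 1 := by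
    intro r hr hd
    have h1 : (p * m).factorization r = 1 :=
      le_antisymm (hsf.natFactorization_le_one r)
        ((hr.dvd_iff_one_le_factorization ha.ne').1 hd)
    rw [← hab, Nat.factorization_mul (by positivity) ha.ne', Nat.factorization_pow,
      Finsupp.add_apply, Finsupp.smul_apply, h1, smul_eq_mul]
    lia
  have hpn : p ∣ p * m := Dvd.intro m rfl
  have hqn : q ∣ p * m := hqm.mul_left p
  refine h4 ?_
  rw [Nat.card_divisors hn0]
  have hsub : ({p, q} : Finset ℕ) ⊆ n.primeFactors := by
    intro r hr
    rw [Finset.mem_insert, Finset.mem_singleton] at hr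
    rw [Nat.mem_primeFactors, ← hab]
    rcases hr with rfl | rfl
    · exact ⟨hp, hpn.mul_left _, by positivity⟩
    · exact ⟨hq, hqn.mul_left _, by positivity⟩
  refine dvd_trans ?_ (Finset.prod_dvd_prod_of_subset _ _ _ hsub)
  rw [Finset.prod_pair hpq]
  exact mul_dvd_mul (even_factor p hp hpn) (even_factor q hq hqn)

theorem stmt3 (n : ℤ) (hn : n ≡ 1 [ZMOD 4]) (hnB : n ∈ Bset (theta 3 1)) :
    Odd ({p : ℕ × ℕ | (∃ a : ℕ, p.1 = a ^ 2) ∧ (∃ b : ℕ, p.2 = b ^ 2) ∧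
        (p.1 : ℤ) + 4 * (p.2 : ℤ) = n}.ncard) ∧
      ∃ p : ℕ, p.Prime ∧ ∃ k : ℤ, n = (p : ℤ) * k ^ 2 := by
  have hn4 : n % 4 = 1 := hn
  obtain ⟨hn3, hodd⟩ := odd_ncard_of_mem_Bset hn4 hnB
  refine ⟨hodd, ?_⟩
  have hsq : ∀ k : ℤ, k ^ 2 ≠ n := by
    intro k h
    rw [← h, sq, Int.mul_emod] at hn3
    have : k % 3 = 0 ∨ k % 3 = 1 ∨ k % 3 = 2 := by lia
    rcases this with h | h | h <;> rw [h] at hn3 <;> norm_num at hn3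
  have hcard : {p : ℕ × ℕ | (∃ a : ℕ, p.1 = a ^ 2) ∧ (∃ b : ℕ, p.2 = b ^ 2) ∧
      (p.1 : ℤ) + 4 * (p.2 : ℤ) = n}.ncard =
      ((Finset.Icc 1 n ×ˢ Finset.Icc 1 n).filter fun p : ℤ × ℤ =>
        p.1 ^ 2 + 4 * p.2 ^ 2 = n).card := by
    rw [← Set.ncard_coe_finset]
    symm
    refine Set.ncard_congr (fun p _ => (p.1.natAbs ^ 2, p.2.natAbs ^ 2)) ?_ ?_ ?_
    · rintro ⟨x, y⟩ h
      have h := (Finset.mem_filter.1 (Finset.mem_coe.1 h)).2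
      exact ⟨⟨_, rfl⟩, ⟨_, rfl⟩, by simpa using h⟩
    · rintro ⟨x, y⟩ ⟨z, w⟩ h1 h2 h
      simp only [Finset.coe_filter, Finset.mem_product, Finset.mem_Icc, Set.mem_ofPred_eq] at h1 h2
      simp only [Prod.mk.injEq, Nat.pow_left_inj (two_ne_zero)] at h ⊢
      lia
    · rintro ⟨_, _⟩ ⟨⟨a, rfl⟩, ⟨b, rfl⟩, h⟩
      push_cast at h
      refine ⟨((a : ℤ), (b : ℤ)), ?_, by simp⟩
      have ha : (a : ℤ) ≠ 0 := by
        intro h0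
        rw [h0] at h
        lia
      have hb : (b : ℤ) ≠ 0 := by
        intro h0
        rw [h0] at h
        exact hsq a (by lia)
      simp only [Finset.coe_filter, Finset.mem_product, Finset.mem_Icc, Set.mem_ofPred_eq]
      refine ⟨⟨⟨by lia, ?_⟩, by lia, ?_⟩, h⟩ <;> nlinarith [sq_nonneg (a : ℤ), sq_nonneg (b : ℤ)]
  have hpos : 0 < n := by
    obtain ⟨p, hp⟩ := Set.nonempty_of_ncard_ne_zero hodd.pos.ne'
    have := hp.2.2
    lia
  lift n to ℕ using hpos.le
  have hsqN : ∀ k : ℕ, k ^ 2 ≠ n := fun k h => hsq k (by exact_mod_cast h)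
  have hdiv : ((Finset.Icc (1 : ℤ) n).filter fun d : ℤ => d ∣ n ∧ d * d < n).card =
      (n.divisors.filter fun d => d * d < n).card := by
    symm
    refine Finset.card_bij (fun d _ => (d : ℤ)) ?_ (fun _ _ _ _ h => by exact_mod_cast h) ?_
    · intro d hd
      rw [Finset.mem_filter, Nat.mem_divisors] at hd
      rw [Finset.mem_filter, Finset.mem_Icc]
      have := Nat.le_of_dvd (by lia) hd.1.1
      have := Nat.pos_of_dvd_of_pos hd.1.1 (by lia)
      exact ⟨⟨by lia, by lia⟩, by exact_mod_cast hd.1.1, by exact_mod_cast hd.2⟩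
    · intro d hd
      rw [Finset.mem_filter, Finset.mem_Icc] at hd
      obtain ⟨⟨h1, -⟩, h2, h3⟩ := hd
      lift d to ℕ using by lia
      refine ⟨d, ?_, rfl⟩
      rw [Finset.mem_filter, Nat.mem_divisors]
      exact ⟨⟨by exact_mod_cast h2, by lia⟩, by exact_mod_cast h3⟩
  have hparity := card_sq_add_four_sq_eq_card_divisors_lt hn4 hsq
  rw [← hcard, hdiv, (ZMod.natCast_eq_one_iff_odd).2 hodd] at hparity
  obtain ⟨j, hj⟩ := (ZMod.natCast_eq_one_iff_odd).1 hparity.symm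
  obtain ⟨p, hp, k, hk⟩ := exists_prime_mul_sq_of_not_four_dvd_card_divisors hsqN (by
    rw [card_divisors_eq_two_mul hsqN, hj]
    lia)
  exact ⟨p, hp, k, by rw [hk]; push_cast; rfl⟩
end

section
/- Let l = 3 and a = [1]. If n ≡ 3 (mod 8), then n ∈ B(a) if and only if the number of ordered triples (r₁, r₂, r₃) of integers with r₁ ≡ r₂ ≡ r₃ ≡ 1 (mod 3) and r₁² + 2r₂² + 8r₃² = n is odd. -/
open scoped Classical

/-- The generating function mod 2 of a weight function `φ : α → ℕ`: the coefficient of `x^k` is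
the number of elements of weight `k`. -/
noncomputable def weightSeries {α : Type*} (φ : α → ℕ) : PowerSeries (ZMod 2) :=
  PowerSeries.mk fun k => (((φ ⁻¹' {k}).ncard : ℕ) : ZMod 2)

theorem weightSeries_mul {α β : Type*} {φ : α → ℕ} {ψ : β → ℕ}
    (hφ : ∀ k, (φ ⁻¹' {k}).Finite) (hψ : ∀ k, (ψ ⁻¹' {k}).Finite) :
    weightSeries φ * weightSeries ψ = weightSeries fun p : α × β => φ p.1 + ψ p.2 := by
  ext n
  simp only [weightSeries, PowerSeries.coeff_mul, PowerSeries.coeff_mk]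
  have key : (fun p : α × β => φ p.1 + ψ p.2) ⁻¹' {n} =
      ((Finset.HasAntidiagonal.antidiagonal n).biUnion fun ij => (hφ ij.1).toFinset ×ˢ (hψ ij.2).toFinset :
        Finset (α × β)) := by
    ext p
    simp
  rw [key, Set.ncard_coe_finset, Finset.card_biUnion]
  · simp [Set.ncard_eq_toFinset_card _ (hφ _), Set.ncard_eq_toFinset_card _ (hψ _)]
  · intro x _ y _ hxy
    rw [Function.onFun, Finset.disjoint_left]
    intro p hp hq
    apply hxy
    simp only [Finset.mem_product, Set.Finite.mem_toFinset, Set.mem_preimage,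
      Set.mem_singleton_iff] at hp hq
    ext
    · rw [← hp.1, hq.1]
    · rw [← hp.2, hq.2]

theorem finite_preimage_add {α β : Type*} {φ : α → ℕ} {ψ : β → ℕ}
    (hφ : ∀ k, (φ ⁻¹' {k}).Finite) (hψ : ∀ k, (ψ ⁻¹' {k}).Finite) (n : ℕ) :
    ((fun p : α × β => φ p.1 + ψ p.2) ⁻¹' {n}).Finite := by
  refine ((Finset.HasAntidiagonal.antidiagonal n).finite_toSet.biUnion
    fun ij _ => (hφ ij.1).prod (hψ ij.2)).subset ?_
  intro p hp
  simpa using hp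

theorem finite_preimage_const_mul {α : Type*} {φ : α → ℕ} (hφ : ∀ k, (φ ⁻¹' {k}).Finite)
    {c : ℕ} (hc : 0 < c) (n : ℕ) : ((fun a => c * φ a) ⁻¹' {n}).Finite := by
  refine (hφ (n / c)).subset ?_
  rintro a rfl
  simp [Nat.mul_div_cancel_left _ hc]

theorem PowerSeries.pow_two_pow_eq_expand (f : PowerSeries (ZMod 2)) (k : ℕ) :
    f ^ 2 ^ k = PowerSeries.expand (2 ^ k) (by positivity) f := by
  have h := MvPowerSeries.map_iterateFrobenius_expand 2 two_ne_zero f k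
  have hid : iterateFrobenius (ZMod 2) 2 k = RingHom.id _ := Subsingleton.elim _ _
  rw [hid, MvPowerSeries.map_id] at h
  exact h.symm

theorem weightSeries_pow_two_pow {α : Type*} (φ : α → ℕ) (k : ℕ) :
    weightSeries φ ^ 2 ^ k = weightSeries fun a => 2 ^ k * φ a := by
  have hk : 0 < 2 ^ k := by positivity
  ext n
  rw [PowerSeries.pow_two_pow_eq_expand, PowerSeries.coeff_expand]
  simp only [weightSeries, PowerSeries.coeff_mk]
  split_ifs with h
  · obtain ⟨m, rfl⟩ := h
    rw [Nat.mul_div_cancel_left _ hk]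
    congr 2
    ext a
    simp
  · have : (fun a => 2 ^ k * φ a) ⁻¹' {n} = ∅ := by
      rw [Set.eq_empty_iff_forall_notMem]
      rintro a rfl
      exact h (dvd_mul_right _ _)
    simp [this]

/-- In characteristic 2, a `2^k`-th power of a Laurent series is a series in `x^(2^k)`. -/
theorem LaurentSeries.coeff_pow_two_pow_eq_zero (f : LaurentSeries (ZMod 2)) (k : ℕ) {n : ℤ}
    (hn : ¬ (2 ^ k : ℤ) ∣ n) : (f ^ 2 ^ k).coeff n = 0 := by
  rw [← f.single_order_mul_powerSeriesPart, mul_pow, HahnSeries.single_pow, ← map_pow,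
    PowerSeries.pow_two_pow_eq_expand, HahnSeries.coeff_single_mul, PowerSeries.coeff_coe]
  split_ifs with h
  · simp
  · rw [PowerSeries.coeff_expand_of_not_dvd, mul_zero]
    intro hd
    apply hn
    have h1 : (2 ^ k : ℤ) ∣ n - 2 ^ k • f.order := by
      have := Int.natCast_dvd.2 hd
      push_cast at this
      exact this
    have h2 : (2 ^ k : ℤ) ∣ 2 ^ k • f.order := by
      rw [nsmul_eq_mul]
      push_cast
      exact dvd_mul_right _ _
    simpa using dvd_add h1 h2

/-- All exponents of `f` are congruent to `j` mod `q`. -/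
def ExponentsMod (q : ℕ) (j : ZMod q) (f : LaurentSeries (ZMod 2)) : Prop :=
  ∀ n ∈ f.support, ((n : ℤ) : ZMod q) = j

theorem ExponentsMod.mul {q : ℕ} {i j : ZMod q} {f g : LaurentSeries (ZMod 2)}
    (hf : ExponentsMod q i f) (hg : ExponentsMod q j g) : ExponentsMod q (i + j) (f * g) := by
  intro n hn
  obtain ⟨s, hs, t, ht, rfl⟩ := HahnSeries.support_mul_subset hn
  simp [hf s hs, hg t ht]

theorem ExponentsMod.pow {q : ℕ} {j : ZMod q} {f : LaurentSeries (ZMod 2)}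
    (hf : ExponentsMod q j f) {k : ℕ} (hk : 0 < k) : ExponentsMod q (k * j) (f ^ k) := by
  induction k, hk using Nat.le_induction with
  | base => simpa using hf
  | succ k _ ih =>
    rw [pow_succ]
    convert ih.mul hf using 1
    push_cast
    ring

theorem ExponentsMod.coeff_eq_zero {q : ℕ} {j : ZMod q} {f : LaurentSeries (ZMod 2)}
    (hf : ExponentsMod q j f) {n : ℤ} (hn : (n : ZMod q) ≠ j) : f.coeff n = 0 := by
  by_contra h
  exact hn (hf n h)

theorem exponentsMod_pow_eight (f : LaurentSeries (ZMod 2)) : ExponentsMod 8 0 (f ^ 8) := by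
  intro n hn
  by_contra h
  refine hn (LaurentSeries.coeff_pow_two_pow_eq_zero f 3 fun hd => h ?_)
  exact (ZMod.intCast_zmod_eq_zero_iff_dvd n 8).2 (by simpa using hd)

/-- The weight `r ↦ r²` on the integers `r ≡ 1 (mod 3)`. -/
def sqWeight (r : {r : ℤ // r ≡ 1 [ZMOD 3]}) : ℕ := r.1.natAbs ^ 2

theorem sqWeight_cast (r : {r : ℤ // r ≡ 1 [ZMOD 3]}) : (sqWeight r : ℤ) = r.1 ^ 2 := by
  simp [sqWeight]

theorem finite_preimage_sqWeight (k : ℕ) : (sqWeight ⁻¹' {k}).Finite := by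
  refine Set.Finite.of_finite_image (f := Subtype.val)
    ((Set.finite_Icc (-(k : ℤ)) k).subset ?_) Subtype.val_injective.injOn
  rintro _ ⟨r, hr, rfl⟩
  have h : r.1 ^ 2 = k := by
    rw [← sqWeight_cast]
    exact_mod_cast hr
  constructor <;> nlinarith

theorem theta_eq_weightSeries : theta 3 1 = weightSeries sqWeight := by
  ext k
  simp only [theta, weightSeries, PowerSeries.coeff_mk]
  congr 1
  rw [← Set.ncard_image_of_injective _ Subtype.val_injective]
  congr 1
  ext r
  simp only [Set.mem_ofPred_eq, Set.mem_image, Set.mem_preimage, Set.mem_singleton_iff,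
    Subtype.exists, exists_and_right, exists_eq_right]
  constructor
  · rintro ⟨h, hr⟩
    refine ⟨h, ?_⟩
    have := sqWeight_cast ⟨r, h⟩
    rw [hr] at this
    exact_mod_cast this
  · rintro ⟨h, rfl⟩
    exact ⟨h, (sqWeight_cast ⟨r, h⟩).symm⟩

theorem theta_coeff_four_mul (m : ℕ) :
    PowerSeries.coeff (4 * m) (theta 3 1) = PowerSeries.coeff m (theta 3 1) := by
  simp only [theta, PowerSeries.coeff_mk]
  congr 1
  rw [← Set.ncard_image_of_injective {n : ℤ | n ≡ 1 [ZMOD 3] ∧ n ^ 2 = (m : ℤ)}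
    (f := fun s => -2 * s) (mul_right_injective₀ (by norm_num))]
  congr 1
  ext r
  simp only [Set.mem_ofPred_eq, Set.mem_image]
  constructor
  · rintro ⟨h, hr⟩
    have h2 : (2 : ℤ) ∣ r := Int.prime_two.dvd_of_dvd_pow (n := 2)
      ⟨2 * m, by rw [hr]; push_cast; ring⟩
    obtain ⟨t, rfl⟩ := h2
    refine ⟨-t, ⟨?_, ?_⟩, by ring⟩
    · rw [Int.ModEq] at *
      omega
    · push_cast at hr
      linarith
  · rintro ⟨s, ⟨h, hs⟩, rfl⟩
    refine ⟨?_, ?_⟩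
    · rw [Int.ModEq] at *
      omega
    · push_cast
      rw [← hs]
      ring

theorem theta_coeff_eq_zero {k : ℕ} (h4 : ¬ 4 ∣ k) (h1 : k % 8 ≠ 1) :
    PowerSeries.coeff k (theta 3 1) = 0 := by
  have : {n : ℤ | n ≡ 1 [ZMOD 3] ∧ n ^ 2 = (k : ℤ)} = ∅ := by
    rw [Set.eq_empty_iff_forall_notMem]
    rintro r ⟨-, hr⟩
    rcases Int.even_or_odd r with ⟨t, rfl⟩ | h
    · have h : (4 : ℤ) ∣ k := ⟨t ^ 2, by rw [← hr]; ring⟩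
      exact h4 (by exact_mod_cast h)
    · obtain ⟨t, rfl⟩ := h
      obtain ⟨u, hu⟩ := Int.even_mul_succ_self t
      have : (k : ℤ) = 8 * u + 1 := by
        rw [← hr]
        linear_combination 4 * hu
      omega
  simp [theta, this]

theorem theta_ne_zero : theta 3 1 ≠ 0 := by
  intro h
  have h1 : PowerSeries.coeff 1 (theta 3 1) = 1 := by
    have : {n : ℤ | n ≡ 1 [ZMOD 3] ∧ n ^ 2 = ((1 : ℕ) : ℤ)} = {1} := by
      ext r
      simp only [Set.mem_ofPred_eq, Set.mem_singleton_iff, Nat.cast_one, sq_eq_one_iff]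
      constructor
      · rintro ⟨h, rfl | rfl⟩
        · rfl
        · exact absurd h (by decide)
      · rintro rfl
        exact ⟨rfl, Or.inl rfl⟩
    rw [theta, PowerSeries.coeff_mk, this, Set.ncard_singleton, Nat.cast_one]
  simp [h] at h1

theorem exponentsMod_theta_add_pow_four : ExponentsMod 8 1 (thetaL 3 1 + thetaL 3 1 ^ 4) := by
  intro n hn
  by_contra h
  apply hn
  have h4 : thetaL 3 1 + thetaL 3 1 ^ 4 =
      ((theta 3 1 + theta 3 1 ^ 2 ^ 2 : PowerSeries (ZMod 2)) : LaurentSeries (ZMod 2)) := by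
    simp [thetaL]
  rw [h4, PowerSeries.coeff_coe]
  split_ifs with hneg
  · rfl
  lift n to ℕ using not_lt.1 hneg
  rw [PowerSeries.pow_two_pow_eq_expand, map_add, PowerSeries.coeff_expand, Int.natAbs_natCast]
  split_ifs with hd
  · obtain ⟨m, rfl⟩ := hd
    rw [Nat.mul_div_cancel_left _ (by norm_num), show 2 ^ 2 * m = 4 * m by norm_num,
      theta_coeff_four_mul, CharTwo.add_self_eq_zero]
  · rw [theta_coeff_eq_zero (by simpa using hd), add_zero]
    intro h1
    apply h
    have := (ZMod.natCast_eq_natCast_iff n 1 8).2 h1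
    exact_mod_cast this

theorem inv_add_pow_eleven {F : Type*} [Field F] (h2 : (2 : F) = 0) {a : F} (ha : a ≠ 0) :
    a⁻¹ + a ^ 11 =
      (a + a ^ 4) ^ 7 * a⁻¹ ^ 8 + (a + a ^ 4) ^ 5 + ((a + a ^ 4) ^ 2 * a⁻¹) ^ 2 := by
  field_simp
  linear_combination -(4 * a ^ 3 + 13 * a ^ 6 + 23 * a ^ 9 + 24 * a ^ 12 + 16 * a ^ 15 +
    6 * a ^ 18 + a ^ 21) * h2

theorem thetaL_inv_coeff {n : ℤ} (hn : n ≡ 3 [ZMOD 8]) :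
    (thetaL 3 1)⁻¹.coeff n = (thetaL 3 1 ^ 11).coeff n := by
  have ha : thetaL 3 1 ≠ 0 := by
    rw [thetaL, Ne, map_eq_zero_iff _ HahnSeries.ofPowerSeries_injective]
    exact theta_ne_zero
  have h2 : (2 : LaurentSeries (ZMod 2)) = 0 := by
    rw [← map_ofNat (HahnSeries.C : ZMod 2 →+* LaurentSeries (ZMod 2)) 2,
      show (OfNat.ofNat 2 : ZMod 2) = 0 from rfl, map_zero]
  have hn8 : (n : ZMod 8) = 3 := by
    have := (ZMod.intCast_eq_intCast_iff n 3 8).2 hn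
    exact_mod_cast this
  have hO := exponentsMod_theta_add_pow_four
  have hsq (f : LaurentSeries (ZMod 2)) : (f ^ 2).coeff n = 0 :=
    LaurentSeries.coeff_pow_two_pow_eq_zero f 1 (by rw [Int.ModEq] at hn; omega)
  have key := congrArg (fun f => f.coeff n) (inv_add_pow_eleven h2 ha)
  simp only [HahnSeries.coeff_add] at key
  rw [((hO.pow (k := 7) (by norm_num)).mul (exponentsMod_pow_eight _)).coeff_eq_zero
      (by rw [hn8]; decide),
    (hO.pow (k := 5) (by norm_num)).coeff_eq_zero (by rw [hn8]; decide),
    hsq,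
    add_zero, add_zero] at key
  exact CharTwo.add_eq_zero.1 key

theorem theta_pow_eleven : theta 3 1 ^ 11 =
    weightSeries fun p : _ × _ × _ => sqWeight p.1 + (2 ^ 1 * sqWeight p.2.1 + 2 ^ 3 * sqWeight p.2.2) := by
  have hf := finite_preimage_sqWeight
  have h1 := finite_preimage_const_mul hf (c := 2 ^ 1) (by norm_num)
  have h3 := finite_preimage_const_mul hf (c := 2 ^ 3) (by norm_num)
  rw [← weightSeries_mul hf (finite_preimage_add h1 h3), ← weightSeries_mul h1 h3,
    ← weightSeries_pow_two_pow, ← weightSeries_pow_two_pow, theta_eq_weightSeries]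
  ring

theorem stmt4 (n : ℤ) (hn : n ≡ 3 [ZMOD 8]) :
    n ∈ Bset (theta 3 1) ↔
      Odd ({r : ℤ × ℤ × ℤ | r.1 ≡ 1 [ZMOD 3] ∧ r.2.1 ≡ 1 [ZMOD 3] ∧ r.2.2 ≡ 1 [ZMOD 3] ∧
        r.1 ^ 2 + 2 * r.2.1 ^ 2 + 8 * r.2.2 ^ 2 = n}.ncard) := by
  have hB : n ∈ Bset (theta 3 1) ↔ (thetaL 3 1 ^ 11).coeff n = 1 := by
    rw [← thetaL_inv_coeff hn]
    rfl
  rw [hB, thetaL, ← map_pow, PowerSeries.coeff_coe]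
  split_ifs with hneg
  · have : {r : ℤ × ℤ × ℤ | r.1 ≡ 1 [ZMOD 3] ∧ r.2.1 ≡ 1 [ZMOD 3] ∧ r.2.2 ≡ 1 [ZMOD 3] ∧
        r.1 ^ 2 + 2 * r.2.1 ^ 2 + 8 * r.2.2 ^ 2 = n} = ∅ := by
      rw [Set.eq_empty_iff_forall_notMem]
      rintro ⟨r, s, t⟩ ⟨-, -, -, h⟩
      dsimp only at h
      nlinarith [sq_nonneg r, sq_nonneg s, sq_nonneg t]
    simp [this]
  lift n to ℕ using not_lt.1 hneg
  rw [theta_pow_eleven, weightSeries, PowerSeries.coeff_mk, Int.natAbs_natCast,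
    ZMod.natCast_eq_one_iff_odd]
  have hinj : Function.Injective (Prod.map Subtype.val (Prod.map Subtype.val Subtype.val) :
      {r : ℤ // r ≡ 1 [ZMOD 3]} × {r : ℤ // r ≡ 1 [ZMOD 3]} × {r : ℤ // r ≡ 1 [ZMOD 3]} → _) :=
    Subtype.val_injective.prodMap (Subtype.val_injective.prodMap Subtype.val_injective)
  rw [← Set.ncard_image_of_injective _ hinj]
  congr! 2
  ext ⟨r, s, t⟩
  simp only [Set.mem_image, Set.mem_preimage, Set.mem_singleton_iff, Set.mem_ofPred_eq,
    Prod.exists, Prod.map_apply, Prod.mk.injEq]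
  constructor
  · rintro ⟨r, s, t, h, rfl, rfl, rfl⟩
    refine ⟨r.2, s.2, t.2, ?_⟩
    rw [← h]
    push_cast [sqWeight_cast]
    ring
  · rintro ⟨hr, hs, ht, h⟩
    refine ⟨⟨r, hr⟩, ⟨s, hs⟩, ⟨t, ht⟩, ?_, rfl, rfl, rfl⟩
    zify
    rw [sqWeight_cast, sqWeight_cast, sqWeight_cast, ← h]
    ring
end

section
/- If n ≡ 11 (mod 24), then the number of ordered triples (s₁, s₂, s₃) of perfect squares (nonnegative integers that are squares) with s₁ + s₂ + s₃ = n equals 3 times the number of ordered triples (r₁, r₂, r₃) of integers with r₁ ≡ r₂ ≡ r₃ ≡ 1 (mod 3) and r₁² + 2r₂² + 8r₃² = n. -/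
open scoped Classical

/-- The squares of `r₂ + 2r₃`, `r₁`, `r₂ - 2r₃`, rotated so that the first occupies slot `i`. -/
def rotatedSquares (p : Fin 3 × ℤ × ℤ × ℤ) : ℕ × ℕ × ℕ :=
  let a := (p.2.2.1 + 2 * p.2.2.2).natAbs ^ 2
  let b := p.2.1.natAbs ^ 2
  let c := (p.2.2.1 - 2 * p.2.2.2).natAbs ^ 2
  if p.1 = 0 then (a, b, c) else if p.1 = 1 then (c, a, b) else (b, c, a)

lemma odd_odd_odd_of_sum_sq_emod_eight {a b c : ℤ} (h : (a ^ 2 + b ^ 2 + c ^ 2) % 8 = 3) :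
    a % 2 = 1 ∧ b % 2 = 1 ∧ c % 2 = 1 := by
  have sq (x : ℤ) : (x % 2 = 1 ∧ x ^ 2 % 8 = 1) ∨ x ^ 2 % 8 = 0 ∨ x ^ 2 % 8 = 4 := by
    have : x % 8 = 0 ∨ x % 8 = 1 ∨ x % 8 = 2 ∨ x % 8 = 3 ∨ x % 8 = 4 ∨ x % 8 = 5 ∨ x % 8 = 6 ∨
        x % 8 = 7 := by omega
    rcases this with h | h | h | h | h | h | h | h <;> simp [pow_two, Int.mul_emod, h] <;> omega
  have := sq a
  have := sq b
  have := sq c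
  omega

lemma sq_emod_three (x : ℤ) : (x % 3 = 0 ∧ x ^ 2 % 3 = 0) ∨ (x % 3 ≠ 0 ∧ x ^ 2 % 3 = 1) := by
  have : x % 3 = 0 ∨ x % 3 = 1 ∨ x % 3 = 2 := by omega
  rcases this with h | h | h <;> simp [pow_two, Int.mul_emod, h]

lemma odd_of_sq_add_two_mul_sq {x y z : ℤ} (h : (x ^ 2 + 2 * y ^ 2 + 8 * z ^ 2) % 8 = 3) :
    y % 2 = 1 := by
  have hx : x ^ 2 % 4 = 0 ∨ x ^ 2 % 4 = 1 := by
    have : x % 4 = 0 ∨ x % 4 = 1 ∨ x % 4 = 2 ∨ x % 4 = 3 := by omega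
    rcases this with h | h | h | h <;> simp [pow_two, Int.mul_emod, h]
  by_contra hy
  obtain ⟨k, rfl⟩ : ∃ k, y = 2 * k := ⟨y / 2, by omega⟩
  have : (2 * k) ^ 2 = 4 * k ^ 2 := by ring
  omega

lemma exists_sign_emod_three {x : ℤ} (hx : x % 3 ≠ 0) (j : ℤ) (hj : j = 1 ∨ j = 2) :
    ∃ y : ℤ, y.natAbs = x.natAbs ∧ y % 3 = j := by
  by_cases h : x % 3 = j
  · exact ⟨x, rfl, h⟩
  · exact ⟨-x, by simp, by omega⟩

lemma exists_ternary_rep {n : ℤ} (hn : n % 24 = 11) {a b c : ℤ} (h : a ^ 2 + b ^ 2 + c ^ 2 = n)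
    (ha : a % 3 = 0) :
    ∃ x y z : ℤ, (x % 3 = 1 ∧ y % 3 = 1 ∧ z % 3 = 1 ∧ x ^ 2 + 2 * y ^ 2 + 8 * z ^ 2 = n) ∧
      (y + 2 * z).natAbs = a.natAbs ∧ x.natAbs = b.natAbs ∧ (y - 2 * z).natAbs = c.natAbs := by
  obtain ⟨ha2, hb2, hc2⟩ := odd_odd_odd_of_sum_sq_emod_eight (a := a) (b := b) (c := c) (by omega)
  have h3a := sq_emod_three a
  have h3b := sq_emod_three b
  have h3c := sq_emod_three c
  obtain ⟨x, hxb, hx⟩ := exists_sign_emod_three (x := b) (by omega) 1 (by simp)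
  obtain ⟨w, hwc, hw⟩ := exists_sign_emod_three (x := c) (by omega) 2 (by simp)
  obtain ⟨v, hva, hv⟩ : ∃ v : ℤ, v.natAbs = a.natAbs ∧ v % 4 = w % 4 := by
    by_cases h : a % 4 = w % 4
    · exact ⟨a, rfl, h⟩
    · have hw2 : w % 2 = 1 := by omega
      exact ⟨-a, by simp, by clear * - h hw2 ha2; omega⟩
  obtain ⟨z, rfl⟩ : ∃ z, v = w + 4 * z := ⟨(v - w) / 4, by omega⟩
  refine ⟨x, w + 2 * z, z, ⟨hx, by omega, by omega, ?_⟩, ?_, hxb, ?_⟩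
  · have h1 := Int.natAbs_eq_iff_sq_eq.1 hxb
    have h2 := Int.natAbs_eq_iff_sq_eq.1 hwc
    have h3 := Int.natAbs_eq_iff_sq_eq.1 hva
    linear_combination h + h1 + h2 + h3
  · rw [← hva]; ring_nf
  · rw [← hwc]; ring_nf

lemma sum_rotatedSquares (i : Fin 3) (x y z : ℤ) :
    ((rotatedSquares (i, x, y, z)).1 : ℤ) + (rotatedSquares (i, x, y, z)).2.1 +
      (rotatedSquares (i, x, y, z)).2.2 = x ^ 2 + 2 * y ^ 2 + 8 * z ^ 2 := by
  fin_cases i <;> simp [rotatedSquares] <;> ring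

lemma injOn_rotatedSquares : Set.InjOn rotatedSquares
    {p | p.2.1 % 3 = 1 ∧ p.2.2.1 % 3 = 1 ∧ p.2.2.2 % 3 = 1 ∧ p.2.2.1 % 2 = 1} := by
  rintro ⟨i, x, y, z⟩ ⟨hx, hy, hz, hy2⟩ ⟨i', x', y', z'⟩ ⟨hx', hy', hz', hy2'⟩ h
  dsimp only at hx hy hz hy2 hx' hy' hz' hy2'
  have key : i = i' ∧ x = x' ∧ y = y' ∧ z = z' := by
    fin_cases i <;> fin_cases i' <;> simp [rotatedSquares] at h ⊢ <;> omega
  obtain ⟨rfl, rfl, rfl, rfl⟩ := key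
  rfl

theorem stmt5 (n : ℤ) (hn : n ≡ 11 [ZMOD 24]) :
    {s : ℕ × ℕ × ℕ | (∃ a : ℕ, s.1 = a ^ 2) ∧ (∃ b : ℕ, s.2.1 = b ^ 2) ∧
        (∃ c : ℕ, s.2.2 = c ^ 2) ∧ (s.1 : ℤ) + (s.2.1 : ℤ) + (s.2.2 : ℤ) = n}.ncard =
      3 * {r : ℤ × ℤ × ℤ | r.1 ≡ 1 [ZMOD 3] ∧ r.2.1 ≡ 1 [ZMOD 3] ∧ r.2.2 ≡ 1 [ZMOD 3] ∧
        r.1 ^ 2 + 2 * r.2.1 ^ 2 + 8 * r.2.2 ^ 2 = n}.ncard := by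
  have hn' : n % 24 = 11 := hn
  set R := {r : ℤ × ℤ × ℤ | r.1 ≡ 1 [ZMOD 3] ∧ r.2.1 ≡ 1 [ZMOD 3] ∧ r.2.2 ≡ 1 [ZMOD 3] ∧
    r.1 ^ 2 + 2 * r.2.1 ^ 2 + 8 * r.2.2 ^ 2 = n}
  have hinj : Set.InjOn rotatedSquares ((Set.univ : Set (Fin 3)) ×ˢ R) := by
    refine injOn_rotatedSquares.mono ?_
    rintro ⟨i, x, y, z⟩ ⟨-, hx, hy, hz, h⟩
    have h8 : (x ^ 2 + 2 * y ^ 2 + 8 * z ^ 2) % 8 = 3 := by rw [h]; omega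
    exact ⟨hx, hy, hz, odd_of_sq_add_two_mul_sq h8⟩
  have hcard : (rotatedSquares '' ((Set.univ : Set (Fin 3)) ×ˢ R)).ncard = 3 * R.ncard := by
    rw [hinj.ncard_image, Set.ncard_prod, Set.ncard_univ, Nat.card_fin]
  rw [← hcard]
  congr 1
  ext ⟨s, t, u⟩
  constructor
  · rintro ⟨⟨a, rfl⟩, ⟨b, rfl⟩, ⟨c, rfl⟩, h⟩
    push_cast at h
    have h3a := sq_emod_three a
    have h3b := sq_emod_three b
    have h3c := sq_emod_three c
    have : (a : ℤ) % 3 = 0 ∨ (b : ℤ) % 3 = 0 ∨ (c : ℤ) % 3 = 0 := by omega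
    rcases this with h0 | h0 | h0
    · obtain ⟨x, y, z, hr, ha, hb, hc⟩ := exists_ternary_rep hn' h h0
      exact ⟨(0, x, y, z), ⟨trivial, hr⟩, by simp [rotatedSquares, ha, hb, hc]⟩
    · obtain ⟨x, y, z, hr, ha, hb, hc⟩ :=
        exists_ternary_rep (a := b) (b := c) (c := a) hn' (by linarith) h0
      exact ⟨(1, x, y, z), ⟨trivial, hr⟩, by simp [rotatedSquares, ha, hb, hc]⟩
    · obtain ⟨x, y, z, hr, ha, hb, hc⟩ :=
        exists_ternary_rep (a := c) (b := a) (c := b) hn' (by linarith) h0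
      exact ⟨(2, x, y, z), ⟨trivial, hr⟩, by simp [rotatedSquares, ha, hb, hc]⟩
  · rintro ⟨⟨i, x, y, z⟩, ⟨-, -, -, -, h⟩, hs⟩
    have hsum := sum_rotatedSquares i x y z
    rw [hs] at hsum
    refine ⟨?_, ?_, ?_, hsum.trans h⟩ <;>
      fin_cases i <;> simp [rotatedSquares] at hs <;> obtain ⟨rfl, rfl, rfl⟩ := hs <;>
      exact ⟨_, rfl⟩
end
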